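/- Let λ, C ∈ ℂ and let u, v, U, V, S : ℝ² → ℂ be smooth functions with u and v nowhere zero, S² = C − UV, S_x = uV + vU, U_x = λU − 2uS and V_x = −λV − 2vS on ℝ². Then the linear generalized invariant manifold relations hold: U_xx − (u_x/u)U_x + 2uvU + 2u²V = λ·(U_x − (u_x/u)U) and V_xx − (v_x/v)V_x + 2uvV + 2v²U = λ·(−V_x + (v_x/v)V). (In operator form this is L₂W = λL₁W with W = (U,V)ᵀ, L₁ = diag(D_x − u_x/u, −D_x + v_x/v), and L₂ the matrix operator with rows (D_x² − (u_x/u)D_x + 2uv, 2u²) and (2v², D_x² − (v_x/v)D_x + 2uv); the ratio L₁⁻¹L₂ is the recursion operator of NLS.) -/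

import Mathlib

open Complex

/-- Partial derivative with respect to the first variable `x`. -/
noncomputable def dX (f : ℝ → ℝ → ℂ) : ℝ → ℝ → ℂ := fun x t => deriv (fun y => f y t) x

/-- `f` is a smooth function of `(x,t) ∈ ℝ²`. -/
def Smooth2 (f : ℝ → ℝ → ℂ) : Prop := ContDiff ℝ (⊤ : ℕ∞) (fun p : ℝ × ℝ => f p.1 p.2)

/-- The restriction of a smooth function to a line of constant `t` is differentiable, with
derivative `dX`. -/
lemma Smooth2.hasDerivAt_dX {f : ℝ → ℝ → ℂ} (hf : Smooth2 f) (x t : ℝ) :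
    HasDerivAt (fun y => f y t) (dX f x t) x := by
  have hd : Differentiable ℝ (fun p : ℝ × ℝ => f p.1 p.2) :=
    ContDiff.differentiable hf (by simp)
  have hline : Differentiable ℝ (fun y : ℝ => f y t) :=
    hd.comp (differentiable_id.prodMk (differentiable_const t))
  exact (hline x).hasDerivAt

/-- Differentiating the first-order relation `F_x = aF − 2wS` and eliminating `S` through the
relation itself gives a second-order equation that involves only `S_x`. -/
lemma dX_dX_eq_of_dX_eq {a : ℂ} {w F S : ℝ → ℝ → ℂ}
    (hw : Smooth2 w) (hF : Smooth2 F) (hS : Smooth2 S) (hwne : ∀ x t, w x t ≠ 0)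
    (hFx : ∀ x t, dX F x t = a * F x t - 2 * w x t * S x t) (x t : ℝ) :
    dX (dX F) x t - dX w x t / w x t * dX F x t + 2 * w x t * dX S x t
      = a * (dX F x t - dX w x t / w x t * F x t) := by
  have hFxx : dX (dX F) x t
      = a * dX F x t - (2 * dX w x t * S x t + 2 * w x t * dX S x t) := by
    have hfun : (fun y => dX F y t) = fun y => a * F y t - 2 * w y t * S y t :=
      funext fun y => hFx y t
    change deriv (fun y => dX F y t) x = _
    rw [hfun]
    exact (((hF.hasDerivAt_dX x t).const_mul a).sub
      (((hw.hasDerivAt_dX x t).const_mul 2).mul (hS.hasDerivAt_dX x t))).deriv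
  have hne := hwne x t
  rw [hFxx, hFx]
  field_simp
  ring

/-- From the nonlinear invariant manifold `U_x = λU − 2uS`, `V_x = −λV − 2vS`,
`S² = C − UV`, `S_x = uV + vU` one derives the consistent pair of linear invariant
manifolds `L₂W = λL₁W` for the NLS system. -/
theorem linear_invariant_manifold_NLS
    (lam C : ℂ) (u v U V S : ℝ → ℝ → ℂ)
    (hu : Smooth2 u) (hv : Smooth2 v) (hU : Smooth2 U) (hV : Smooth2 V) (hS : Smooth2 S)
    (hune : ∀ x t, u x t ≠ 0) (hvne : ∀ x t, v x t ≠ 0)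
    (hS2 : ∀ x t, (S x t) ^ 2 = C - U x t * V x t)
    (hSx : ∀ x t, dX S x t = u x t * V x t + v x t * U x t)
    (hUx : ∀ x t, dX U x t = lam * U x t - 2 * u x t * S x t)
    (hVx : ∀ x t, dX V x t = -lam * V x t - 2 * v x t * S x t) :
    (∀ x t, dX (dX U) x t - dX u x t / u x t * dX U x t
        + 2 * u x t * v x t * U x t + 2 * (u x t) ^ 2 * V x t
      = lam * (dX U x t - dX u x t / u x t * U x t)) ∧
    (∀ x t, dX (dX V) x t - dX v x t / v x t * dX V x t
        + 2 * u x t * v x t * V x t + 2 * (v x t) ^ 2 * U x t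
      = lam * (-(dX V x t) + dX v x t / v x t * V x t)) := by
  refine ⟨fun x t => ?_, fun x t => ?_⟩
  · have h := dX_dX_eq_of_dX_eq hu hU hS hune hUx x t
    rw [hSx] at h
    linear_combination h
  · have h := dX_dX_eq_of_dX_eq hv hV hS hvne hVx x t
    rw [hSx] at h
    linear_combination h
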